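/- Let χ̃ be a Hecke character of weight one of ℚ(ρ) with conductor (β). Then the central value equation L(1, χ̃) = C(χ̃)·conj(L(1, χ̃)) holds, where the root number is C(χ̃) = −ρ·β^{−1}·Σ_{λ mod β} χ₁(λ)·e^{2πi·S(λ/β)}. -/

import Mathlib

open Complex BigOperators

noncomputable section

/-- `ρ = e^{2πi/3}`, a primitive cube root of unity. -/
def ρ3 : ℂ := Complex.exp (2 * Real.pi * Complex.I / 3)

/-- The ring of Eisenstein integers `ℤ[ρ]`, realized as a subring of `ℂ`. -/
def O3 : Subring ℂ := Subring.closure {ρ3}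

/-- `√−3 = i·√3`. -/
def sqrtm3 : ℂ := Complex.I * (Real.sqrt 3 : ℝ)

/-- The congruence `a ≡ b (mod c)` in `ℤ[ρ]`. -/
def ECong (a b c : ℂ) : Prop := ∃ d ∈ O3, a - b = c * d

/-- `a` and `b` are coprime in `ℤ[ρ]`. -/
def ECoprime (a b : ℂ) : Prop := ∃ u ∈ O3, ∃ v ∈ O3, u * a + v * b = 1

/-- The real period `ϖ₁ = ∫₀¹ (1−x³)^{−2/3} dx`. -/
def varpi1 : ℝ := ∫ x in (0:ℝ)..(1:ℝ), (1 - x ^ 3) ^ (-(2:ℝ)/3)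

/-- The points of the period lattice `ϖ₁·ℤ[ρ]`. -/
def ω3 (m : ℤ × ℤ) : ℂ := (varpi1 : ℂ) * ((m.1 : ℂ) + (m.2 : ℂ) * ρ3)

/-- The Weierstrass `℘`-function of the period lattice `ϖ₁·ℤ[ρ]`
(so that `℘′² = 4℘³ − 27`). -/
def wp3 (u : ℂ) : ℂ :=
  (u ^ 2)⁻¹ + ∑' m : ℤ × ℤ, if m = 0 then 0 else (((u - ω3 m) ^ 2)⁻¹ - ((ω3 m) ^ 2)⁻¹)

/-- The derivative `℘′` of the Weierstrass `℘`-function of `ϖ₁·ℤ[ρ]`. -/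
def wp3' (u : ℂ) : ℂ := ∑' m : ℤ × ℤ, (-2) * ((u - ω3 m) ^ 3)⁻¹

/-- The Weierstrass `ζ`-function of the period lattice `ϖ₁·ℤ[ρ]`. -/
def wzeta3 (u : ℂ) : ℂ :=
  u⁻¹ + ∑' m : ℤ × ℤ, if m = 0 then 0 else ((u - ω3 m)⁻¹ + (ω3 m)⁻¹ + u * ((ω3 m) ^ 2)⁻¹)

/-- The non-analytic doubly periodic function `Z(u) = ζ(ϖ₁u) − (2π/(√3·ϖ₁))·ū`. -/
def Z3 (u : ℂ) : ℂ :=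
  wzeta3 ((varpi1 : ℂ) * u) -
    ((2 * Real.pi / (Real.sqrt 3 * varpi1) : ℝ) : ℂ) * (starRingEnd ℂ) u

/-- The elliptic function `φ(u) = 6℘(ϖ₁u)/(9+℘′(ϖ₁u))` of period lattice `ℤ[ρ]`. -/
def phi3 (u : ℂ) : ℂ := 6 * wp3 ((varpi1 : ℂ) * u) / (9 + wp3' ((varpi1 : ℂ) * u))

/-- The elliptic function `ψ(u) = (9−℘′(ϖ₁u))/(9+℘′(ϖ₁u))` of period lattice `ℤ[ρ]`. -/
def psi3 (u : ℂ) : ℂ := (9 - wp3' ((varpi1 : ℂ) * u)) / (9 + wp3' ((varpi1 : ℂ) * u))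

/-- A residue class character modulo `β` on `ℤ[ρ]`. -/
structure IsResChar3 (β : ℂ) (χ : ℂ → ℂ) : Prop where
  periodic : ∀ a ∈ O3, ∀ b ∈ O3, ECong a b β → χ a = χ b
  map_mul : ∀ a ∈ O3, ∀ b ∈ O3, χ (a * b) = χ a * χ b
  map_one : χ 1 = 1
  vanish : ∀ a ∈ O3, ¬ ECoprime a β → χ a = 0

/-- The cubic residue character `χ_π = (·/π)₃` modulo a prime `π` with `p = π·π̄`:
`χ_π(ν)³ = 1` and `χ_π(ν) ≡ ν^{(p−1)/3} (mod π)`. -/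
structure IsCubicChar (π : ℂ) (p : ℕ) (χ : ℂ → ℂ) : Prop where
  resChar : IsResChar3 π χ
  cube : ∀ ν ∈ O3, ECoprime ν π → χ ν ^ 3 = 1
  euler : ∀ ν ∈ O3, ECoprime ν π → ECong (χ ν) (ν ^ ((p - 1) / 3)) π

/-- The elliptic Gauss sum `G_π(χ, f) = (1/3)·Σ_{ν ∈ (ℤ[ρ]/(π))^×} χ(ν)·f(ν/π)`,
computed via the integer representatives `1, …, p−1` of `(ℤ[ρ]/(π))^× ≅ (ℤ/p)^×`. -/
def EGS3 (p : ℕ) (χ f : ℂ → ℂ) (π : ℂ) : ℂ :=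
  (1/3 : ℂ) * ∑ r ∈ Finset.Icc 1 (p - 1), χ (r : ℂ) * f ((r : ℂ) / π)

/-- `S` is a third set of `(ℤ[ρ]/(π))^×`, i.e. `(ℤ[ρ]/(π))^× = S ∪ ρS ∪ ρ̄S`. -/
def IsThirdSet (π : ℂ) (S : Finset ℂ) : Prop :=
  (∀ ν ∈ S, ν ∈ O3 ∧ ECoprime ν π) ∧
  (∀ a ∈ O3, ECoprime a π →
    ∃ ν ∈ S, ∃ ε ∈ ({1, ρ3, ρ3 ^ 2} : Set ℂ), ECong a (ε * ν) π) ∧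
  (∀ ν ∈ S, ∀ μ ∈ S, ∀ ε ∈ ({1, ρ3, ρ3 ^ 2} : Set ℂ), ∀ ε' ∈ ({1, ρ3, ρ3 ^ 2} : Set ℂ),
    ECong (ε * ν) (ε' * μ) π → ν = μ ∧ ε = ε')

/-- `γ(S)` is the cube root of unity with `γ(S) ≡ −∏_{ν∈S} ν (mod π)`. -/
def IsGamma3 (π : ℂ) (S : Finset ℂ) (γ : ℂ) : Prop :=
  γ ^ 3 = 1 ∧ ECong γ (-(∏ ν ∈ S, ν)) π

/-- `L` is the value at `s = 1` of the analytic continuation of the Hecke `L`-series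
`L(s, χ̃) = Σ_𝔞 χ̃(𝔞)·N𝔞^{−s} = (1/6)·Σ_{ν ∈ ℤ[ρ]} χ₁(ν)·ν̄·|ν|^{−2s}` attached to the
weight-one Hecke character `χ̃((ν)) = χ₁(ν)·ν̄` of `ℚ(ρ)`. -/
def IsLValue3 (χ₁ : ℂ → ℂ) (L : ℂ) : Prop :=
  ∃ F : ℂ → ℂ, DifferentiableOn ℂ F {s : ℂ | 0 < s.re} ∧
    (∀ s : ℂ, 3/2 < s.re →
      F s = (1/6 : ℂ) *
        ∑' ν : O3, χ₁ (ν : ℂ) * (starRingEnd ℂ) (ν : ℂ) *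
          ((Complex.normSq (ν : ℂ) : ℂ) ^ (-s))) ∧
    F 1 = L

/-- `T` is a complete residue system modulo `β` in `ℤ[ρ]`. -/
def IsCRS3 (β : ℂ) (T : Finset ℂ) : Prop :=
  (∀ a ∈ T, a ∈ O3) ∧ (∀ a ∈ T, ∀ b ∈ T, ECong a b β → a = b) ∧
  (∀ z ∈ O3, ∃ a ∈ T, ECong z a β)

/-- `e^{2πi·S(z)}` where `S(a + b·ρ̄) = a`, i.e. `2πi·S(z) = (2π/√3)·(zρ − z̄ρ̄)`. -/
def eS3 (z : ℂ) : ℂ :=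
  Complex.exp (((2 * Real.pi / Real.sqrt 3 : ℝ) : ℂ) *
    (z * ρ3 - (starRingEnd ℂ) z * (starRingEnd ℂ) ρ3))

/-- `χ₀`: the character mod `3` giving the natural isomorphism `(ℤ[ρ]/(3))^× ≅ W`,
i.e. `χ₀(ν) = ε` for `ν ≡ ε (mod 3)`, `ε ∈ W = {±1, ±ρ, ±ρ̄}`. -/
def IsChi0₃ (χ₀ : ℂ → ℂ) : Prop :=
  IsResChar3 3 χ₀ ∧ ∀ ε ∈ ({1, -1, ρ3, -ρ3, ρ3 ^ 2, -ρ3 ^ 2} : Set ℂ), χ₀ ε = ε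

/-- `χ₀′`: the character mod `√−3` giving `(ℤ[ρ]/(√−3))^× ≅ {±1}`,
i.e. `χ₀′(ν) = δ` for `ν ≡ δ (mod √−3)`, `δ ∈ {±1}`. -/
def IsChi0'₃ (χ₀' : ℂ → ℂ) : Prop :=
  IsResChar3 sqrtm3 χ₀' ∧ χ₀' (-1) = -1

/-- The classical cubic (Kummer) Gauss sum `G₃(π) = Σ_{r=1}^{p−1} (r/π)₃·e^{2πir/p}`. -/
def G3sum (p : ℕ) (χ : ℂ → ℂ) : ℂ :=
  ∑ r ∈ Finset.Icc 1 (p - 1), χ (r : ℂ) * Complex.exp (2 * Real.pi * Complex.I * (r : ℂ) / (p : ℂ))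


/-- `χ` is a primitive residue class character modulo `β` on `ℤ[ρ]`. -/
def IsPrimitive3 (β : ℂ) (χ : ℂ → ℂ) : Prop :=
  ∀ β' ∈ O3, (∃ c ∈ O3, β = β' * c) → ¬ (∃ c ∈ O3, β' = β * c) →
    ∃ a ∈ O3, ECoprime a β ∧ ECong a 1 β' ∧ χ a ≠ 1

/-- `χ̃((ν)) = χ₁(ν)·ν̄` is a Hecke character of weight one of `ℚ(ρ)` with
conductor `(β)`: `χ₁` is a primitive residue class character mod `(β)` with
`χ₁(ε) = ε` for every unit `ε ∈ W = {±1, ±ρ, ±ρ̄}`. -/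
def IsHeckeCond3 (β : ℂ) (χ₁ : ℂ → ℂ) : Prop :=
  β ∈ O3 ∧ β ≠ 0 ∧ IsResChar3 β χ₁ ∧
    (∀ ε ∈ ({1, -1, ρ3, -ρ3, ρ3 ^ 2, -ρ3 ^ 2} : Set ℂ), χ₁ ε = ε) ∧
    IsPrimitive3 β χ₁

lemma ρ3_eq : ρ3 = -(1 / 2) + (Real.sqrt 3 / 2 : ℝ) * I := by
  have h : (2 * Real.pi * I / 3 : ℂ) = ((2 * Real.pi / 3 : ℝ) : ℂ) * I := by push_cast; ring
  have hc : Real.cos (2 * Real.pi / 3) = -(1 / 2) := by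
    rw [show 2 * Real.pi / 3 = Real.pi - Real.pi / 3 by ring, Real.cos_pi_sub, Real.cos_pi_div_three]
  have hs : Real.sin (2 * Real.pi / 3) = Real.sqrt 3 / 2 := by
    rw [show 2 * Real.pi / 3 = Real.pi - Real.pi / 3 by ring, Real.sin_pi_sub, Real.sin_pi_div_three]
  rw [ρ3, h, exp_mul_I, ← ofReal_cos, ← ofReal_sin, hc, hs]
  push_cast
  ring

lemma ρ3_re : ρ3.re = -(1 / 2) := by
  rw [ρ3_eq]
  simp

lemma ρ3_im : ρ3.im = Real.sqrt 3 / 2 := by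
  rw [ρ3_eq]
  simp

lemma ρ3_sq : ρ3 ^ 2 = -1 - ρ3 := by
  have h3 : Real.sqrt 3 * Real.sqrt 3 = 3 := Real.mul_self_sqrt (by norm_num)
  apply Complex.ext
  · simp only [sq, mul_re, sub_re, neg_re, one_re, ρ3_re, ρ3_im]
    linarith
  · simp only [sq, mul_im, sub_im, neg_im, one_im, ρ3_re, ρ3_im]
    ring

lemma conj_ρ3 : (starRingEnd ℂ) ρ3 = ρ3 ^ 2 := by
  rw [ρ3_sq]
  apply Complex.ext
  · simp only [conj_re, sub_re, neg_re, one_re, ρ3_re]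
    norm_num
  · simp only [conj_im, sub_im, neg_im, one_im, ρ3_im]
    ring

lemma ρ3_cube : ρ3 ^ 3 = 1 := by
  linear_combination (ρ3 - 1) * ρ3_sq

lemma ρ3_mem : ρ3 ∈ O3 := Subring.subset_closure rfl

/-- The Eisenstein integer with given coordinates in the basis `1, ρ`. -/
def eisOf (p : ℤ × ℤ) : ℂ := p.1 + p.2 * ρ3

lemma eisOf_mem (p : ℤ × ℤ) : eisOf p ∈ O3 :=
  add_mem (intCast_mem _ _) (mul_mem (intCast_mem _ _) ρ3_mem)

lemma eisOf_re (p : ℤ × ℤ) : (eisOf p).re = p.1 - p.2 / 2 := by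
  simp [eisOf, ρ3_re]
  ring

lemma eisOf_im (p : ℤ × ℤ) : (eisOf p).im = p.2 * (Real.sqrt 3 / 2) := by
  simp [eisOf, ρ3_im]

lemma eisOf_injective : Function.Injective eisOf := by
  intro p q h
  have h1 := congrArg re h
  have h2 := congrArg im h
  rw [eisOf_re, eisOf_re] at h1
  rw [eisOf_im, eisOf_im] at h2
  have h3 : (p.2 : ℝ) = q.2 := mul_right_cancel₀ (by positivity) h2
  rw [h3] at h1
  have h4 : (p.1 : ℝ) = q.1 := by linarith
  exact Prod.ext (by exact_mod_cast h4) (by exact_mod_cast h3)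

lemma exists_eisOf {z : ℂ} (hz : z ∈ O3) : ∃ p, eisOf p = z := by
  induction hz using Subring.closure_induction with
  | mem x hx => exact ⟨(0, 1), by rw [Set.mem_singleton_iff.1 hx]; simp [eisOf]⟩
  | zero => exact ⟨0, by simp [eisOf]⟩
  | one => exact ⟨(1, 0), by simp [eisOf]⟩
  | add x y _ _ hx hy =>
    obtain ⟨p, rfl⟩ := hx
    obtain ⟨q, rfl⟩ := hy
    exact ⟨p + q, by simp [eisOf]; ring⟩
  | neg x _ hx =>
    obtain ⟨p, rfl⟩ := hx
    exact ⟨-p, by simp [eisOf]; ring⟩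
  | mul x y _ _ hx hy =>
    obtain ⟨p, rfl⟩ := hx
    obtain ⟨q, rfl⟩ := hy
    refine ⟨(p.1 * q.1 - p.2 * q.2, p.1 * q.2 + p.2 * q.1 - p.2 * q.2), ?_⟩
    simp only [eisOf]
    push_cast
    linear_combination (-(p.2 : ℂ) * q.2) * ρ3_sq

/-- The coordinates of an Eisenstein integer. -/
def eisEquiv : ℤ × ℤ ≃ O3 :=
  Equiv.ofBijective (fun p => ⟨eisOf p, eisOf_mem p⟩)
    ⟨fun _ _ h => eisOf_injective (congrArg Subtype.val h),
      fun z => (exists_eisOf z.2).imp fun _ h => Subtype.ext h⟩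

@[simp] lemma eisEquiv_coe (p : ℤ × ℤ) : (eisEquiv p : ℂ) = eisOf p := rfl

lemma normSq_eisOf (p : ℤ × ℤ) :
    normSq (eisOf p) = ((p.1 ^ 2 - p.1 * p.2 + p.2 ^ 2 : ℤ) : ℝ) := by
  have h3 : Real.sqrt 3 * Real.sqrt 3 = 3 := Real.mul_self_sqrt (by norm_num)
  rw [normSq_apply, eisOf_re, eisOf_im]
  push_cast
  linear_combination (p.2 ^ 2 / 4 : ℝ) * h3

lemma exists_normSq_eq_natCast {z : ℂ} (hz : z ∈ O3) : ∃ n : ℕ, normSq z = n := by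
  obtain ⟨p, rfl⟩ := exists_eisOf hz
  have h0 := normSq_nonneg (eisOf p)
  rw [normSq_eisOf] at h0 ⊢
  obtain ⟨n, hn⟩ := Int.eq_ofNat_of_zero_le (Int.cast_nonneg_iff.1 h0)
  exact ⟨n, by rw [hn]; rfl⟩

lemma one_le_normSq {z : ℂ} (hz : z ∈ O3) (h0 : z ≠ 0) : 1 ≤ normSq z := by
  obtain ⟨n, hn⟩ := exists_normSq_eq_natCast hz
  have h := normSq_pos.2 h0
  rw [hn] at h ⊢
  exact_mod_cast h

lemma norm_prod_le_norm_eisOf (p : ℤ × ℤ) : ‖p‖ ≤ 2 * ‖eisOf p‖ := by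
  have h : normSq (eisOf p) = ‖eisOf p‖ ^ 2 := normSq_eq_norm_sq _
  rw [normSq_eisOf] at h
  push_cast at h
  rw [Prod.norm_def, sup_le_iff, Int.norm_eq_abs, Int.norm_eq_abs]
  constructor <;> refine abs_le_of_sq_le_sq ?_ (by positivity)
  · nlinarith [sq_nonneg ((p.1 : ℝ) - 2 * p.2), sq_nonneg (p.1 : ℝ)]
  · nlinarith [sq_nonneg ((p.2 : ℝ) - 2 * p.1), sq_nonneg (p.2 : ℝ)]

lemma summable_norm_prod_rpow {k : ℝ} (hk : 2 < k) :
    Summable fun p : ℤ × ℤ => ‖p‖ ^ (-k) := by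
  rw [← (finTwoArrowEquiv ℤ).summable_iff]
  refine (EisensteinSeries.summable_one_div_norm_rpow hk).congr fun x => ?_
  congr 1
  simp [EisensteinSeries.norm_eq_max_natAbs, Prod.norm_def, Int.norm_eq_abs, finTwoArrowEquiv, Nat.cast_natAbs]

lemma summable_norm_eisOf_rpow {k : ℝ} (hk : 2 < k) :
    Summable fun p : ℤ × ℤ => ‖eisOf p‖ ^ (-k) := by
  refine ((summable_norm_prod_rpow hk).mul_left (2 ^ k)).of_nonneg_of_le
    (fun p => by positivity) fun p => ?_
  rcases eq_or_ne p 0 with rfl | hp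
  · rw [show eisOf 0 = 0 by simp [eisOf], norm_zero, Real.zero_rpow (by linarith)]
    positivity
  · have h := norm_prod_le_norm_eisOf p
    have hp' : 0 < ‖p‖ := norm_pos_iff.2 hp
    have h2 := Real.rpow_le_rpow_of_nonpos hp' h (by linarith : -k ≤ 0)
    rw [Real.mul_rpow (by norm_num) (norm_nonneg _), Real.rpow_neg (by norm_num : (0:ℝ) ≤ 2)] at h2
    rwa [inv_mul_le_iff₀ (by positivity)] at h2

lemma mul_exp_neg_sq_le {a u : ℝ} (ha : 0 < a) (hu : 0 ≤ u) :
    u * Real.exp (-a * u ^ 2) ≤ 8 * (1 + 4 / a ^ 2) * ((1 + u) ^ (3 : ℕ))⁻¹ := by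
  have h1 := Real.pow_div_factorial_le_exp (a * u ^ 2) (by positivity) 2
  have h2 : u ^ 4 * Real.exp (-a * u ^ 2) ≤ 2 / a ^ 2 := by
    rw [neg_mul, Real.exp_neg, ← div_eq_mul_inv, div_le_div_iff₀ (Real.exp_pos _) (by positivity)]
    norm_num [Nat.factorial] at h1
    linarith
  have h3 : Real.exp (-a * u ^ 2) ≤ 1 := Real.exp_le_one_iff.2 (by nlinarith [sq_nonneg u])
  have h4 : u * (1 + u) ^ 3 ≤ 8 * (1 + 2 * u ^ 4) := by
    nlinarith [sq_nonneg (u - 1), sq_nonneg (u ^ 2 - 1), sq_nonneg (u ^ 2 - u), sq_nonneg u]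
  rw [← div_eq_mul_inv, le_div_iff₀ (by positivity)]
  calc u * Real.exp (-a * u ^ 2) * (1 + u) ^ 3 = u * (1 + u) ^ 3 * Real.exp (-a * u ^ 2) := by ring
    _ ≤ 8 * (1 + 2 * u ^ 4) * Real.exp (-a * u ^ 2) := by gcongr
    _ = 8 * (Real.exp (-a * u ^ 2) + 2 * (u ^ 4 * Real.exp (-a * u ^ 2))) := by ring
    _ ≤ 8 * (1 + 2 * (2 / a ^ 2)) := by gcongr
    _ = _ := by ring

lemma summable_inv_one_add_norm_eisOf :
    Summable fun p : ℤ × ℤ => ((1 + ‖eisOf p‖) ^ (3 : ℕ))⁻¹ := by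
  refine ((summable_norm_eisOf_rpow (k := 3) (by norm_num)).add
    (summable_of_hasFiniteSupport (f := fun p => if p = 0 then (1 : ℝ) else 0)
      ((Set.finite_singleton 0).subset fun p hp => by
        by_contra h
        exact hp (if_neg h)))).of_nonneg_of_le (fun p => by positivity) fun p => ?_
  rcases eq_or_ne p 0 with rfl | hp
  · rw [show eisOf 0 = 0 by simp [eisOf]]
    norm_num
  · rw [if_neg hp, add_zero, Real.rpow_neg (norm_nonneg _)]
    have h : 0 < ‖eisOf p‖ := by
      have := norm_prod_le_norm_eisOf p
      have hp' : 0 < ‖p‖ := norm_pos_iff.2 hp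
      linarith
    have e : ‖eisOf p‖ ^ (3 : ℝ) = ‖eisOf p‖ ^ (3 : ℕ) := by
      rw [← Real.rpow_natCast]
      norm_num
    rw [e]
    gcongr
    linarith

lemma summable_norm_mul_exp {a : ℝ} (ha : 0 < a) (z : ℂ) :
    Summable fun p : ℤ × ℤ => ‖eisOf p - z‖ * Real.exp (-a * ‖eisOf p - z‖ ^ 2) := by
  refine (summable_inv_one_add_norm_eisOf.mul_left
    (8 * (1 + 4 / a ^ 2) * (1 + ‖z‖) ^ 3)).of_nonneg_of_le (fun p => by positivity) fun p => ?_
  refine (mul_exp_neg_sq_le ha (norm_nonneg _)).trans ?_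
  rw [mul_assoc (8 * (1 + 4 / a ^ 2)) ((1 + ‖z‖) ^ 3)]
  gcongr
  rw [← div_eq_mul_inv, inv_eq_one_div, div_le_div_iff₀ (by positivity) (by positivity), one_mul,
    ← mul_pow]
  gcongr
  have := norm_le_norm_sub_add (eisOf p) z
  nlinarith [norm_nonneg z, norm_nonneg (eisOf p - z)]

/-- Poisson summation in the first coordinate. -/
lemma tsum_gauss_fst {t : ℝ} (ht : 0 < t) (x : ℝ) (n : ℤ) :
    ∑' m : ℤ, cexp (2 * Real.pi * I * x * m) *
        cexp ((-(2 * Real.pi / Real.sqrt 3 * t) * (m ^ 2 - m * n + n ^ 2) : ℝ)) =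
      1 / (2 * t / Real.sqrt 3 : ℂ) ^ (1 / 2 : ℂ) *
        ∑' k : ℤ, cexp (-(Real.sqrt 3 * Real.pi / (2 * t)) * (k - x) ^ 2) *
          cexp (-(Real.sqrt 3 * Real.pi * t / 2) * n ^ 2 + Real.pi * I * n * (x - k)) := by
  have h3 : (Real.sqrt 3 : ℂ) ^ 2 = 3 := by exact_mod_cast Real.sq_sqrt (by norm_num : (0:ℝ) ≤ 3)
  have h30 : (Real.sqrt 3 : ℂ) ≠ 0 := by
    intro h
    rw [h] at h3
    norm_num at h3
  have ht0 : (t : ℂ) ≠ 0 := by exact_mod_cast ht.ne'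
  have hpi : (Real.pi : ℂ) ≠ 0 := by exact_mod_cast Real.pi_ne_zero
  have key := jacobiTheta₂_functional_equation (x - I * t * n / Real.sqrt 3)
    (2 * I * t / Real.sqrt 3)
  have e1 : -I * (2 * I * t / Real.sqrt 3) = 2 * t / Real.sqrt 3 := by
    linear_combination (-(2 * t / Real.sqrt 3) : ℂ) * I_sq
  rw [e1, jacobiTheta₂, jacobiTheta₂] at key
  have key2 := congrArg (fun w => w * cexp (-(2 * Real.pi / Real.sqrt 3 * t) * n ^ 2)) key
  simp only [← tsum_mul_left, ← tsum_mul_right] at key2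
  rw [← tsum_mul_left]
  convert! key2 using 3 with m k
  · rw [jacobiTheta₂_term, ← Complex.exp_add, ← Complex.exp_add]
    congr 1
    push_cast
    field_simp
    linear_combination (m * t * n - m ^ 2 * t : ℂ) * I_sq
  · rw [jacobiTheta₂_term, ← Complex.exp_add, mul_assoc (1 / _), mul_assoc (1 / _),
      ← Complex.exp_add, ← Complex.exp_add]
    congr 2
    field_simp
    linear_combination (-(t ^ 2 * n ^ 2) : ℂ) * h3 + (t ^ 2 * n ^ 2 : ℂ) * I_sq

/-- Poisson summation in the second coordinate. -/
lemma tsum_gauss_snd {t : ℝ} (ht : 0 < t) (w : ℝ) :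
    ∑' n : ℤ, (n : ℂ) * (cexp (2 * Real.pi * I * w * n) *
        cexp (-(Real.sqrt 3 * Real.pi * t / 2) * n ^ 2)) =
      1 / (Real.sqrt 3 * t / 2 : ℂ) ^ (1 / 2 : ℂ) * (2 / (I * Real.sqrt 3 * t)) *
        ∑' l : ℤ, (l - w : ℂ) * cexp (-(2 * Real.pi / (Real.sqrt 3 * t)) * (l - w) ^ 2) := by
  have h3 : (Real.sqrt 3 : ℂ) ^ 2 = 3 := by exact_mod_cast Real.sq_sqrt (by norm_num : (0:ℝ) ≤ 3)
  have h30 : (Real.sqrt 3 : ℂ) ≠ 0 := by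
    intro h
    rw [h] at h3
    norm_num at h3
  have ht0 : (t : ℂ) ≠ 0 := by exact_mod_cast ht.ne'
  have hpi : (Real.pi : ℂ) ≠ 0 := by exact_mod_cast Real.pi_ne_zero
  have key := jacobiTheta₂'_functional_equation w (I * Real.sqrt 3 * t / 2)
  have e1 : -I * (I * Real.sqrt 3 * t / 2) = Real.sqrt 3 * t / 2 := by
    linear_combination (-(Real.sqrt 3 * t / 2) : ℂ) * I_sq
  have e2 : -1 / (I * Real.sqrt 3 * t / 2) = 2 * I / (Real.sqrt 3 * t) := by
    field_simp
    linear_combination -I_sq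
  have him : 0 < (2 * I / (Real.sqrt 3 * t)).im := by
    have : 2 * I / (Real.sqrt 3 * t) = ((2 / (Real.sqrt 3 * t) : ℝ) : ℂ) * I := by
      push_cast; ring
    rw [this, im_ofReal_mul, I_im]
    positivity
  rw [e1, e2, ← (hasSum_jacobiTheta₂'_term _ him).tsum_eq, ← (hasSum_jacobiTheta₂_term _ him).tsum_eq,
    ← tsum_mul_left, ← (hasSum_jacobiTheta₂'_term _ him).summable.tsum_sub
      ((hasSum_jacobiTheta₂_term _ him).summable.mul_left _), jacobiTheta₂'] at key
  have key2 := congrArg (fun u => (2 * Real.pi * I)⁻¹ * u) key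
  simp only [← tsum_mul_left] at key2
  rw [← tsum_mul_left]
  convert! key2 using 3 with m l
  · rw [jacobiTheta₂'_term, jacobiTheta₂_term, ← Complex.exp_add]
    field_simp
    congr 2
    linear_combination (-m ^ 2 * Real.pi * Real.sqrt 3 * t / 2 : ℂ) * I_sq
  · have e3 : cexp (-(2 * Real.pi / (Real.sqrt 3 * t)) * (l - w) ^ 2) =
        cexp (-Real.pi * I * w ^ 2 / (I * Real.sqrt 3 * t / 2)) *
          jacobiTheta₂_term l (w / (I * Real.sqrt 3 * t / 2)) (2 * I / (Real.sqrt 3 * t)) := by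
      rw [jacobiTheta₂_term, ← Complex.exp_add]
      congr 1
      field_simp
      linear_combination (-l ^ 2 : ℂ) * I_sq
    rw [e3, jacobiTheta₂'_term]
    field_simp

lemma normSq_coord (x y : ℝ) : normSq (x + y * ρ3) = x ^ 2 - x * y + y ^ 2 := by
  have h3 : Real.sqrt 3 * Real.sqrt 3 = 3 := Real.mul_self_sqrt (by norm_num)
  rw [normSq_apply]
  simp only [add_re, add_im, ofReal_re, ofReal_im, re_ofReal_mul, im_ofReal_mul, ρ3_re, ρ3_im]
  linear_combination (y ^ 2 / 4 : ℝ) * h3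

lemma exists_coord (z : ℂ) : ∃ x y : ℝ, z = x + y * ρ3 := by
  have h3 : Real.sqrt 3 * Real.sqrt 3 = 3 := Real.mul_self_sqrt (by norm_num)
  have h30 : Real.sqrt 3 ≠ 0 := by positivity
  refine ⟨z.re + z.im / Real.sqrt 3, 2 * z.im / Real.sqrt 3, ?_⟩
  apply Complex.ext
  · simp only [add_re, ofReal_re, re_ofReal_mul, ρ3_re]
    ring
  · simp only [add_im, ofReal_im, im_ofReal_mul, ρ3_im]
    field_simp
    ring

lemma eS3_coord (x y : ℝ) : eS3 (x + y * ρ3) = cexp (2 * Real.pi * I * (x - y)) := by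
  have h3 : (Real.sqrt 3 : ℂ) ^ 2 = 3 := by exact_mod_cast Real.sq_sqrt (by norm_num : (0:ℝ) ≤ 3)
  have h30 : (Real.sqrt 3 : ℂ) ≠ 0 := by
    intro h
    rw [h] at h3
    norm_num at h3
  have e : ρ3 - ρ3 ^ 2 = I * Real.sqrt 3 := by
    rw [ρ3_sq, ρ3_eq]
    push_cast
    ring
  rw [eS3]
  congr 1
  simp only [map_add, map_mul, conj_ofReal, conj_ρ3]
  have e2 : (x + y * ρ3) * ρ3 - (x + y * ρ3 ^ 2) * ρ3 ^ 2 = (x - y) * (I * Real.sqrt 3) := by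
    linear_combination (x - y : ℂ) * e - (y * ρ3 : ℂ) * ρ3_cube
  rw [e2]
  push_cast
  field_simp

lemma eS3_add (z w : ℂ) : eS3 (z + w) = eS3 z * eS3 w := by
  rw [eS3, eS3, eS3, ← Complex.exp_add]
  congr 1
  rw [map_add]
  ring

lemma eS3_mem {z : ℂ} (hz : z ∈ O3) : eS3 z = 1 := by
  obtain ⟨p, rfl⟩ := exists_eisOf hz
  have h := eS3_coord p.1 p.2
  push_cast at h
  rw [eisOf, h, show (2 * Real.pi * I * (p.1 - p.2) : ℂ) = (p.1 - p.2 : ℤ) * (2 * Real.pi * I) by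
    push_cast; ring, exp_int_mul_two_pi_mul_I]

lemma norm_eS3 (z : ℂ) : ‖eS3 z‖ = 1 := by
  obtain ⟨x, y, rfl⟩ := exists_coord z
  rw [eS3_coord, show (2 * Real.pi * I * (x - y) : ℂ) = (2 * Real.pi * (x - y) : ℝ) * I by
    push_cast; ring, norm_exp_ofReal_mul_I]

lemma summable_exp_neg_mul_sub_sq {a : ℝ} (ha : 0 < a) (x : ℝ) :
    Summable fun k : ℤ => Real.exp (-a * (k - x) ^ 2) := by
  have him : 0 < (I * a / Real.pi).im := by
    rw [show I * a / Real.pi = ((a / Real.pi : ℝ) : ℂ) * I by push_cast; ring, im_ofReal_mul, I_im]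
    positivity
  have h := ((summable_jacobiTheta₂_term_iff (-(I * a * x / Real.pi)) _).2 him).norm
  refine (h.mul_left (Real.exp (-a * x ^ 2))).congr fun k => ?_
  have hpi : (Real.pi : ℂ) ≠ 0 := by exact_mod_cast Real.pi_ne_zero
  have e : jacobiTheta₂_term k (-(I * a * x / Real.pi)) (I * a / Real.pi) =
      ((Real.exp (2 * a * k * x - a * k ^ 2) : ℝ) : ℂ) := by
    rw [jacobiTheta₂_term, ofReal_exp]
    congr 1
    push_cast
    field_simp
    linear_combination (k * a * (k - 2 * x) : ℂ) * I_sq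
  rw [e, norm_real, Real.norm_eq_abs, Real.abs_exp, ← Real.exp_add]
  congr 1
  ring

lemma summable_abs_mul_exp_neg_sq {b : ℝ} (hb : 0 < b) :
    Summable fun n : ℤ => |(n : ℝ)| * Real.exp (-b * n ^ 2) := by
  have him : 0 < (I * b / Real.pi).im := by
    rw [show I * b / Real.pi = ((b / Real.pi : ℝ) : ℂ) * I by push_cast; ring, im_ofReal_mul, I_im]
    positivity
  have h := ((summable_jacobiTheta₂'_term_iff 0 _).2 him).norm
  refine (h.mul_left (2 * Real.pi)⁻¹).congr fun n => ?_
  have hpi : (Real.pi : ℂ) ≠ 0 := by exact_mod_cast Real.pi_ne_zero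
  have e : jacobiTheta₂_term n 0 (I * b / Real.pi) = ((Real.exp (-b * n ^ 2) : ℝ) : ℂ) := by
    rw [jacobiTheta₂_term, ofReal_exp]
    congr 1
    push_cast
    field_simp
    linear_combination (n ^ 2 * b : ℂ) * I_sq
  have hp : (Real.pi : ℝ) ≠ 0 := Real.pi_ne_zero
  rw [jacobiTheta₂'_term, e, norm_mul, norm_real, Real.norm_eq_abs, Real.abs_exp]
  simp [abs_of_pos Real.pi_pos]
  field_simp

lemma cpow_half_mul {t : ℝ} (ht : 0 < t) :
    1 / (2 * t / Real.sqrt 3 : ℂ) ^ (1 / 2 : ℂ) * (1 / (Real.sqrt 3 * t / 2 : ℂ) ^ (1 / 2 : ℂ)) =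
      1 / t := by
  rw [one_div_mul_one_div]
  congr 1
  have h := mul_cpow_ofReal_nonneg (a := 2 * t / Real.sqrt 3) (b := Real.sqrt 3 * t / 2)
    (by positivity) (by positivity) (1 / 2)
  push_cast at h
  rw [← h]
  have h30 : Real.sqrt 3 ≠ 0 := by positivity
  have e : (2 * t / Real.sqrt 3 * (Real.sqrt 3 * t / 2) : ℂ) = ((t ^ 2 : ℝ) : ℂ) := by
    have : (Real.sqrt 3 : ℂ) ≠ 0 := by exact_mod_cast h30
    push_cast
    field_simp
  rw [e, show (1 / 2 : ℂ) = ((1 / 2 : ℝ) : ℂ) by push_cast; rfl, ← ofReal_cpow (by positivity),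
    ← Real.sqrt_eq_rpow, Real.sqrt_sq ht.le]

/-- The shear relating the iterated Poisson summation variables to lattice coordinates. -/
def shearEquiv : ℤ × ℤ ≃ ℤ × ℤ where
  toFun p := (p.1 - p.2, -p.1)
  invFun q := (-q.2, -q.2 - q.1)
  left_inv p := by simp
  right_inv q := by simp

lemma summable_theta_left {t : ℝ} (ht : 0 < t) (z : ℂ) :
    Summable fun p : ℤ × ℤ => ((eisOf p).im : ℂ) * eS3 (z * eisOf p) *
      cexp ((-(2 * Real.pi / Real.sqrt 3 * t) * normSq (eisOf p) : ℝ)) := by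
  refine (summable_norm_mul_exp (a := 2 * Real.pi / Real.sqrt 3 * t) (by positivity)
    0).of_norm_bounded fun p => ?_
  rw [norm_mul, norm_mul, norm_eS3, mul_one, ← ofReal_exp, norm_real, norm_real,
    Real.norm_eq_abs, Real.norm_eq_abs, Real.abs_exp, sub_zero, normSq_eq_norm_sq]
  gcongr
  exact abs_im_le_norm _

lemma summable_theta_right {t : ℝ} (ht : 0 < t) (z : ℂ) :
    Summable fun p : ℤ × ℤ => ((ρ3 * (eisOf p - z)).re : ℂ) *
      cexp ((-(2 * Real.pi / (Real.sqrt 3 * t)) * normSq (eisOf p - z) : ℝ)) := by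
  refine (summable_norm_mul_exp (a := 2 * Real.pi / (Real.sqrt 3 * t)) (by positivity)
    z).of_norm_bounded fun p => ?_
  rw [norm_mul, ← ofReal_exp, norm_real, norm_real,
    Real.norm_eq_abs, Real.norm_eq_abs, Real.abs_exp, normSq_eq_norm_sq]
  gcongr
  refine (abs_re_le_norm _).trans ?_
  have hρ : ‖ρ3‖ = 1 := by
    have := congrArg norm ρ3_cube
    rw [norm_pow, norm_one] at this
    exact (pow_eq_one_iff_of_nonneg (norm_nonneg _) (by norm_num)).1 this
  rw [norm_mul, hρ, one_mul]

/-- Two-dimensional theta inversion for the Eisenstein lattice. -/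
lemma theta_inversion {t : ℝ} (ht : 0 < t) (z : ℂ) :
    ∑' p : ℤ × ℤ, ((eisOf p).im : ℂ) * eS3 (z * eisOf p) *
        cexp ((-(2 * Real.pi / Real.sqrt 3 * t) * normSq (eisOf p) : ℝ)) =
      -I / t ^ 2 * ∑' p : ℤ × ℤ, ((ρ3 * (eisOf p - z)).re : ℂ) *
        cexp ((-(2 * Real.pi / (Real.sqrt 3 * t)) * normSq (eisOf p - z) : ℝ)) := by
  obtain ⟨x, y, rfl⟩ := exists_coord z
  have h3 : (Real.sqrt 3 : ℂ) ^ 2 = 3 := by exact_mod_cast Real.sq_sqrt (by norm_num : (0:ℝ) ≤ 3)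
  have h30 : (Real.sqrt 3 : ℂ) ≠ 0 := by
    intro h
    rw [h] at h3
    norm_num at h3
  have ht0 : (t : ℂ) ≠ 0 := by exact_mod_cast ht.ne'
  set P : ℂ := 1 / (2 * t / Real.sqrt 3 : ℂ) ^ (1 / 2 : ℂ) with hP
  set P' : ℂ := 1 / (Real.sqrt 3 * t / 2 : ℂ) ^ (1 / 2 : ℂ) with hP'
  have hPP : P * P' = 1 / t := cpow_half_mul ht
  let w : ℤ → ℝ := fun k => -x + (x - y - k) / 2
  let B : ℤ → ℤ → ℂ := fun n k =>
    Real.sqrt 3 / 2 * P * cexp (-(Real.sqrt 3 * Real.pi / (2 * t)) * (k - (x - y : ℝ)) ^ 2) *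
      (n * (cexp (2 * Real.pi * I * w k * n) * cexp (-(Real.sqrt 3 * Real.pi * t / 2) * n ^ 2)))
  have hB : Summable (Function.uncurry B) := by
    refine (((summable_abs_mul_exp_neg_sq (b := Real.sqrt 3 * Real.pi * t / 2)
      (by positivity)).mul_of_nonneg (summable_exp_neg_mul_sub_sq
        (a := Real.sqrt 3 * Real.pi / (2 * t)) (by positivity) (x - y)) (fun _ => by positivity)
        (fun _ => by positivity)).mul_left ‖(Real.sqrt 3 / 2 * P : ℂ)‖).of_norm_bounded
          fun p => le_of_eq ?_
    obtain ⟨n, k⟩ := p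
    have e1 : cexp (-(Real.sqrt 3 * Real.pi / (2 * t)) * (k - (x - y : ℝ)) ^ 2) =
        (Real.exp (-(Real.sqrt 3 * Real.pi / (2 * t)) * (k - (x - y)) ^ 2) : ℝ) := by
      push_cast; rfl
    have e2 : cexp (-(Real.sqrt 3 * Real.pi * t / 2) * n ^ 2) =
        (Real.exp (-(Real.sqrt 3 * Real.pi * t / 2) * n ^ 2) : ℝ) := by
      push_cast; rfl
    have e3 : ‖cexp (2 * Real.pi * I * w k * n)‖ = 1 := by
      rw [show (2 * Real.pi * I * w k * n : ℂ) = (2 * Real.pi * w k * n : ℝ) * I by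
        push_cast; ring, norm_exp_ofReal_mul_I]
    simp only [Function.uncurry, B]
    rw [norm_mul, norm_mul, norm_mul, norm_mul, norm_mul, e1, e2, e3, norm_real, norm_real, one_mul,
      Real.norm_eq_abs, Real.norm_eq_abs, Real.abs_exp, Real.abs_exp, norm_intCast]
    ring
  have hfst (n : ℤ) : ∑' m : ℤ, ((eisOf (m, n)).im : ℂ) * eS3 ((x + y * ρ3) * eisOf (m, n)) *
        cexp ((-(2 * Real.pi / Real.sqrt 3 * t) * normSq (eisOf (m, n)) : ℝ)) =
      ∑' k : ℤ, B n k := by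
    have h := congrArg (fun u => Real.sqrt 3 / 2 * n * cexp (2 * Real.pi * I * (-x) * n) * u)
      (tsum_gauss_fst ht (x - y) n)
    simp only [← tsum_mul_left] at h
    convert! h using 3 with m k
    · have e : (x + y * ρ3) * eisOf (m, n) =
          ((x * m - y * n : ℝ) : ℂ) + ((x * n + y * m - y * n : ℝ) : ℂ) * ρ3 := by
        simp only [eisOf]
        push_cast
        linear_combination (y * n : ℂ) * ρ3_sq
      rw [e, eS3_coord, normSq_eisOf, eisOf_im]
      have e4 : cexp (2 * Real.pi * I * (((x * m - y * n : ℝ) : ℂ) - (x * n + y * m - y * n : ℝ))) =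
          cexp (2 * Real.pi * I * (-x) * n) * cexp (2 * Real.pi * I * (x - y : ℝ) * m) := by
        rw [← Complex.exp_add]
        congr 1
        push_cast
        ring
      rw [e4]
      push_cast
      ring
    · have e4 : cexp (2 * Real.pi * I * w k * n) = cexp (2 * Real.pi * I * (-x) * n) *
          cexp (Real.pi * I * n * ((x - y : ℝ) - k)) := by
        rw [← Complex.exp_add]
        congr 1
        simp only [w]
        push_cast
        ring
      simp only [B]
      rw [e4, Complex.exp_add]
      ring
  have hsnd (k : ℤ) : ∑' n : ℤ, B n k = ∑' l : ℤ, -I / t ^ 2 *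
      (((ρ3 * (eisOf (shearEquiv.symm (k, l)) - (x + y * ρ3))).re : ℂ) *
        cexp ((-(2 * Real.pi / (Real.sqrt 3 * t)) *
          normSq (eisOf (shearEquiv.symm (k, l)) - (x + y * ρ3)) : ℝ))) := by
    simp only [B]
    rw [tsum_mul_left, tsum_gauss_snd ht, ← hP', ← tsum_mul_left, ← tsum_mul_left]
    congr 1
    ext l
    have e : eisOf (shearEquiv.symm (k, l)) - (x + y * ρ3) =
        ((-l - x : ℝ) : ℂ) + ((-l - k - y : ℝ) : ℂ) * ρ3 := by
      simp only [eisOf, shearEquiv, Equiv.coe_fn_symm_mk]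
      push_cast
      ring
    have e5 : (ρ3 * (((-l - x : ℝ) : ℂ) + ((-l - k - y : ℝ) : ℂ) * ρ3)).re = l - w k := by
      rw [show ρ3 * (((-l - x : ℝ) : ℂ) + ((-l - k - y : ℝ) : ℂ) * ρ3) =
        ((-l - x : ℝ) : ℂ) * ρ3 + ((-l - k - y : ℝ) : ℂ) * ρ3 ^ 2 by ring, ρ3_sq]
      simp only [add_re, re_ofReal_mul, sub_re, neg_re, one_re, ρ3_re, w]
      ring
    rw [e, e5, normSq_coord]
    have e6 : cexp (-(Real.sqrt 3 * Real.pi / (2 * t)) * (k - (x - y : ℝ)) ^ 2) *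
        cexp (-(2 * Real.pi / (Real.sqrt 3 * t)) * (l - w k) ^ 2) =
        cexp ((-(2 * Real.pi / (Real.sqrt 3 * t)) *
          ((-l - x) ^ 2 - (-l - x) * (-l - k - y) + (-l - k - y) ^ 2) : ℝ)) := by
      rw [← Complex.exp_add]
      congr 1
      simp only [w]
      push_cast
      field_simp
      linear_combination (-(k - (x - y)) ^ 2 : ℂ) * h3
    rw [← e6]
    have e7 : -I / t ^ 2 = Real.sqrt 3 / 2 * (P * P') * (2 / (I * Real.sqrt 3 * t)) := by
      rw [hPP]
      field_simp
      linear_combination -I_sq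
    rw [e7]
    push_cast
    ring
  have hA := summable_theta_left ht (x + y * ρ3)
  have hD := (summable_theta_right ht (x + y * ρ3)).mul_left (-I / t ^ 2)
  have hA' := ((Equiv.prodComm ℤ ℤ).summable_iff.2 hA).tsum_prod
  have hD' := (shearEquiv.symm.summable_iff.2 hD).tsum_prod
  simp only [Equiv.prodComm_apply, Prod.swap_prod_mk, Function.comp_apply, hfst, ← hsnd] at hA' hD'
  rw [← tsum_mul_left]
  refine ((Equiv.prodComm ℤ ℤ).tsum_eq _).symm.trans
    (hA'.trans (hB.tsum_comm.symm.trans (hD'.symm.trans ?_)))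
  exact shearEquiv.symm.tsum_eq fun p => -I / t ^ 2 * (((ρ3 * (eisOf p - (x + y * ρ3))).re : ℂ) *
    cexp ((-(2 * Real.pi / (Real.sqrt 3 * t)) * normSq (eisOf p - (x + y * ρ3)) : ℝ)))

lemma exists_normSq_sub_lt_one (z : ℂ) : ∃ q ∈ O3, normSq (z - q) < 1 := by
  obtain ⟨x, y, rfl⟩ := exists_coord z
  refine ⟨eisOf (round x, round y), eisOf_mem _, ?_⟩
  have e : x + y * ρ3 - eisOf (round x, round y) =
      ((x - round x : ℝ) : ℂ) + ((y - round y : ℝ) : ℂ) * ρ3 := by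
    simp only [eisOf]
    push_cast
    ring
  rw [e, normSq_coord]
  have hx := abs_le.1 (abs_sub_round x)
  have hy := abs_le.1 (abs_sub_round y)
  nlinarith [hx.1, hx.2, hy.1, hy.2]

lemma exists_gcd {a b : ℂ} (ha : a ∈ O3) (hb : b ∈ O3) (hb0 : b ≠ 0) :
    ∃ d ∈ O3, d ≠ 0 ∧ (∃ c ∈ O3, a = d * c) ∧ (∃ c ∈ O3, b = d * c) ∧
      ∃ u ∈ O3, ∃ v ∈ O3, u * a + v * b = d := by
  classical
  let C : ℕ → Prop := fun n => ∃ u ∈ O3, ∃ v ∈ O3, u * a + v * b ≠ 0 ∧ normSq (u * a + v * b) = n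
  have hex : ∃ n, C n := by
    obtain ⟨n, hn⟩ := exists_normSq_eq_natCast hb
    exact ⟨n, 0, zero_mem _, 1, one_mem _, by simpa using hb0, by simpa using hn⟩
  obtain ⟨u, hu, v, hv, hd0, hdn⟩ := Nat.find_spec hex
  set d := u * a + v * b with hd
  have hdm : d ∈ O3 := add_mem (mul_mem hu ha) (mul_mem hv hb)
  have key : ∀ r ∈ O3, ∀ s ∈ O3, ∃ c ∈ O3, r * a + s * b = d * c := by
    intro r hr s hs
    obtain ⟨q, hq, hlt⟩ := exists_normSq_sub_lt_one ((r * a + s * b) / d)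
    refine ⟨q, hq, ?_⟩
    by_contra hne
    have e : (r - q * u) * a + (s - q * v) * b = d * ((r * a + s * b) / d - q) := by
      rw [mul_sub, mul_div_cancel₀ _ hd0]
      rw [hd]
      ring
    have hr' : r - q * u ∈ O3 := sub_mem hr (mul_mem hq hu)
    have hs' : s - q * v ∈ O3 := sub_mem hs (mul_mem hq hv)
    obtain ⟨n, hn⟩ := exists_normSq_eq_natCast (add_mem (mul_mem hr' ha) (mul_mem hs' hb))
    have hlt' : n < Nat.find hex := by
      have : (n : ℝ) < Nat.find hex := by
        rw [← hn, ← hdn, e, normSq_mul]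
        nlinarith [normSq_pos.2 hd0]
      exact_mod_cast this
    refine Nat.find_min hex hlt' ⟨_, hr', _, hs', ?_, hn⟩
    rw [e, mul_sub, mul_div_cancel₀ _ hd0]
    exact sub_ne_zero.2 hne
  refine ⟨d, hdm, hd0, ?_, ?_, u, hu, v, hv, rfl⟩
  · simpa using key 1 (one_mem _) 0 (zero_mem _)
  · simpa using key 0 (zero_mem _) 1 (one_mem _)

lemma ECong.symm {a b c : ℂ} (h : ECong a b c) : ECong b a c := by
  obtain ⟨d, hd, e⟩ := h
  exact ⟨-d, neg_mem hd, by linear_combination -e⟩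

lemma ECong.trans {a b c m : ℂ} (h : ECong a b m) (h' : ECong b c m) : ECong a c m := by
  obtain ⟨d, hd, e⟩ := h
  obtain ⟨d', hd', e'⟩ := h'
  exact ⟨d + d', add_mem hd hd', by linear_combination e + e'⟩

lemma ECong.mul_left {a b m u : ℂ} (hu : u ∈ O3) (h : ECong a b m) :
    ECong (u * a) (u * b) m := by
  obtain ⟨d, hd, e⟩ := h
  exact ⟨u * d, mul_mem hu hd, by linear_combination u * e⟩

lemma ECoprime.exists_inv {a β : ℂ} (h : ECoprime a β) : ∃ u ∈ O3, ECong (u * a) 1 β := by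
  obtain ⟨u, hu, v, hv, e⟩ := h
  exact ⟨u, hu, -v, neg_mem hv, by linear_combination e⟩

lemma IsCRS3.sum_mul_left {β : ℂ} {T : Finset ℂ} (hT : IsCRS3 β T) {h : ℂ → ℂ}
    (hh : ∀ a ∈ O3, ∀ b ∈ O3, ECong a b β → h a = h b) {a : ℂ} (ha : a ∈ O3)
    (hco : ECoprime a β) : ∑ l ∈ T, h (a * l) = ∑ l ∈ T, h l := by
  obtain ⟨hTO, hTinj, hTex⟩ := hT
  obtain ⟨u, hu, hua⟩ := hco.exists_inv
  choose r hr hrc using fun z : O3 => hTex z z.2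
  have cancel : ∀ x ∈ O3, ECong (u * (a * x)) x β := by
    intro x hx
    have := ECong.mul_left hx hua
    rw [mul_one] at this
    rwa [show u * (a * x) = x * (u * a) by ring]
  refine Finset.sum_bij (fun l hl => r ⟨a * l, mul_mem ha (hTO l hl)⟩) (fun l hl => hr _) ?_ ?_ ?_
  · intro x hx y hy hxy
    have h1 := hrc ⟨a * x, mul_mem ha (hTO x hx)⟩
    have h2 := hrc ⟨a * y, mul_mem ha (hTO y hy)⟩
    rw [← hxy] at h2
    exact hTinj x hx y hy (((cancel x (hTO x hx)).symm.trans
      (ECong.mul_left hu (h1.trans h2.symm))).trans (cancel y (hTO y hy)))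
  · intro t ht
    have h1 := hrc ⟨u * t, mul_mem hu (hTO t ht)⟩
    refine ⟨r ⟨u * t, mul_mem hu (hTO t ht)⟩, hr _, ?_⟩
    refine hTinj _ (hr _) _ ht ((hrc ⟨a * r ⟨u * t, _⟩, mul_mem ha (hTO _ (hr _))⟩).symm.trans
      ((ECong.mul_left ha h1.symm).trans ?_))
    simpa only [mul_left_comm] using cancel t (hTO t ht)
  · intro l hl
    exact hh _ (mul_mem ha (hTO l hl)) _ (hTO _ (hr _))
      (hrc ⟨a * l, mul_mem ha (hTO l hl)⟩)

lemma IsResChar3.map_pow {β : ℂ} {χ : ℂ → ℂ} (hχ : IsResChar3 β χ) {a : ℂ} (ha : a ∈ O3) (n : ℕ) :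
    χ (a ^ n) = χ a ^ n := by
  induction n with
  | zero => simp [hχ.map_one]
  | succ n ih => rw [pow_succ, hχ.map_mul _ (pow_mem ha n) _ ha, ih, pow_succ]

lemma IsResChar3.norm_eq_one {β : ℂ} {χ : ℂ → ℂ} (hχ : IsResChar3 β χ) {T : Finset ℂ}
    (hT : IsCRS3 β T) {a : ℂ} (ha : a ∈ O3) (hco : ECoprime a β) : ‖χ a‖ = 1 := by
  have hne : χ a ≠ 0 := by
    obtain ⟨u, hu, hua⟩ := hco.exists_inv
    have h := hχ.periodic _ (mul_mem hu ha) _ (one_mem _) hua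
    rw [hχ.map_mul _ hu _ ha, hχ.map_one] at h
    exact right_ne_zero_of_mul_eq_one h
  choose r hr hrc using fun z : O3 => hT.2.2 z z.2
  obtain ⟨i, j, hij, h⟩ := Finite.exists_ne_map_eq_of_infinite
    (fun n : ℕ => (⟨r ⟨a ^ n, pow_mem ha n⟩, hr _⟩ : T))
  have h' : r ⟨a ^ i, pow_mem ha i⟩ = r ⟨a ^ j, pow_mem ha j⟩ := congrArg Subtype.val h
  have hi := hrc ⟨a ^ i, pow_mem ha i⟩
  rw [h'] at hi
  have hc := hχ.periodic _ (pow_mem ha i) _ (pow_mem ha j) (hi.trans (hrc _).symm)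
  rw [hχ.map_pow ha, hχ.map_pow ha] at hc
  have hn := congrArg norm hc
  rw [norm_pow, norm_pow] at hn
  by_contra h1
  exact hij (pow_right_injective₀ (norm_pos_iff.2 hne) h1 hn)

lemma IsResChar3.norm_le_one {β : ℂ} {χ : ℂ → ℂ} (hχ : IsResChar3 β χ) {T : Finset ℂ}
    (hT : IsCRS3 β T) {a : ℂ} (ha : a ∈ O3) : ‖χ a‖ ≤ 1 := by
  by_cases hco : ECoprime a β
  · exact (hχ.norm_eq_one hT ha hco).le
  · rw [hχ.vanish a ha hco, norm_zero]
    exact zero_le_one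

/-- Separability of the Gauss sum of a primitive character. -/
lemma sum_char_mul_eS3 {β : ℂ} {χ : ℂ → ℂ} (hβ : β ∈ O3) (hβ0 : β ≠ 0) (hχ : IsResChar3 β χ)
    (hprim : IsPrimitive3 β χ) {T : Finset ℂ} (hT : IsCRS3 β T) {ν : ℂ} (hν : ν ∈ O3) :
    ∑ l ∈ T, χ l * eS3 (l / β * ν) = (starRingEnd ℂ) (χ ν) * ∑ l ∈ T, χ l * eS3 (l / β) := by
  have eper : ∀ ν ∈ O3, ∀ a ∈ O3, ∀ b ∈ O3, ECong a b β →
      χ a * eS3 (a / β * ν) = χ b * eS3 (b / β * ν) := by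
    intro ν hν a ha b hb hab
    rw [hχ.periodic a ha b hb hab]
    obtain ⟨d, hd, e⟩ := hab
    have e' : a / β * ν = b / β * ν + d * ν := by
      field_simp
      linear_combination ν * e
    rw [e', eS3_add, eS3_mem (mul_mem hd hν), mul_one]
  by_cases hco : ECoprime ν β
  · have h1 := hT.sum_mul_left (h := fun a => χ a * eS3 (a / β))
      (fun a ha b hb hab => by simpa using eper 1 (one_mem _) a ha b hb hab) hν hco
    rw [← h1, Finset.mul_sum]
    refine Finset.sum_congr rfl fun l hl => ?_
    rw [hχ.map_mul _ hν _ (hT.1 l hl), ← mul_assoc, ← mul_assoc, ← normSq_eq_conj_mul_self,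
      normSq_eq_norm_sq, hχ.norm_eq_one hT hν hco, show ν * l / β = l / β * ν by ring]
    simp
  · rw [hχ.vanish ν hν hco, map_zero, zero_mul]
    obtain ⟨d, hd, hd0, ⟨c, hc, hνc⟩, ⟨β', hβ', hβd⟩, u, hu, v, hv, huv⟩ := exists_gcd hν hβ hβ0
    have hβ'0 : β' ≠ 0 := by
      rintro rfl
      exact hβ0 (by rw [hβd, mul_zero])
    obtain ⟨a, ha, hac, ⟨k, hk, hak⟩, hχa⟩ := hprim β' hβ' ⟨d, hd, by rw [hβd, mul_comm]⟩ (by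
      rintro ⟨e, he, hβe⟩
      apply hco
      have hde : d * e = 1 := by
        have : β' * (d * e) = β' * 1 := by
          rw [mul_one]
          nth_rewrite 2 [hβe]
          rw [hβd]
          ring
        exact mul_left_cancel₀ hβ'0 this
      exact ⟨e * u, mul_mem he hu, e * v, mul_mem he hv, by linear_combination e * huv + hde⟩)
    have h1 := hT.sum_mul_left (h := fun a => χ a * eS3 (a / β * ν))
      (fun a ha b hb hab => eper ν hν a ha b hb hab) ha hac
    have h2 : ∑ l ∈ T, χ (a * l) * eS3 (a * l / β * ν) =
        χ a * ∑ l ∈ T, χ l * eS3 (l / β * ν) := by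
      rw [Finset.mul_sum]
      refine Finset.sum_congr rfl fun l hl => ?_
      have e : a * l / β * ν = l / β * ν + k * l * c := by
        rw [hβd, hνc]
        field_simp
        linear_combination l * c * hak
      rw [hχ.map_mul _ ha _ (hT.1 l hl), e, eS3_add,
        eS3_mem (mul_mem (mul_mem hk (hT.1 l hl)) hc), mul_one, mul_assoc]
    rw [h2] at h1
    have h3 : (χ a - 1) * ∑ l ∈ T, χ l * eS3 (l / β * ν) = 0 := by linear_combination h1
    exact (mul_eq_zero.1 h3).resolve_left (sub_ne_zero.2 hχa)

/-- The splitting of the lattice into residue classes. -/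
lemma IsCRS3.sum_tsum {β : ℂ} {T : Finset ℂ} (hβ : β ∈ O3) (hβ0 : β ≠ 0) (hT : IsCRS3 β T)
    {f : ℂ → ℂ} (hf : Summable fun p => f (eisOf p)) :
    ∑ l ∈ T, ∑' p, f (l - β * eisOf p) = ∑' p, f (eisOf p) := by
  let φ : T × (ℤ × ℤ) → O3 := fun x =>
    ⟨x.1 - β * eisOf x.2, sub_mem (hT.1 _ x.1.2) (mul_mem hβ (eisOf_mem _))⟩
  have hφ : Function.Bijective φ := by
    constructor
    · rintro ⟨⟨l, hl⟩, p⟩ ⟨⟨l', hl'⟩, p'⟩ h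
      have h' : l - β * eisOf p = l' - β * eisOf p' := congrArg Subtype.val h
      have hll : l = l' := hT.2.1 l hl l' hl' ⟨eisOf p - eisOf p',
        sub_mem (eisOf_mem _) (eisOf_mem _), by linear_combination h'⟩
      subst hll
      have : eisOf p = eisOf p' := mul_left_cancel₀ hβ0 (by linear_combination -h')
      rw [eisOf_injective this]
    · rintro ⟨z, hz⟩
      obtain ⟨l, hl, d, hd, e⟩ := hT.2.2 z hz
      obtain ⟨p, hp⟩ := exists_eisOf (neg_mem hd)
      refine ⟨(⟨l, hl⟩, p), Subtype.ext ?_⟩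
      change l - β * eisOf p = z
      rw [hp]
      linear_combination -e
  let e := (Equiv.ofBijective φ hφ).trans eisEquiv.symm
  have he (x) : eisOf (e x) = x.1 - β * eisOf x.2 := by
    change eisOf (eisEquiv.symm (φ x)) = _
    rw [← eisEquiv_coe, Equiv.apply_symm_apply]
  have h := (e.summable_iff.2 hf).tsum_prod
  simp only [Function.comp_apply, he] at h
  rw [← e.tsum_eq]
  simp only [he]
  rw [h, tsum_fintype, ← Finset.sum_coe_sort T]

/-- Multiplication by `ρ` in lattice coordinates. -/
def rotEquiv : ℤ × ℤ ≃ ℤ × ℤ where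
  toFun p := (-p.2, p.1 - p.2)
  invFun q := (q.2 - q.1, -q.1)
  left_inv p := by simp
  right_inv q := by simp

lemma eisOf_rotEquiv (p : ℤ × ℤ) : eisOf (rotEquiv p) = ρ3 * eisOf p := by
  simp only [eisOf, rotEquiv, Equiv.coe_fn_mk]
  push_cast
  linear_combination -p.2 * ρ3_sq

lemma normSq_ρ3 : normSq ρ3 = 1 := by
  have h : ((normSq ρ3 : ℝ) : ℂ) = 1 := by
    rw [normSq_eq_conj_mul_self, conj_ρ3, ← pow_succ, ρ3_cube]
  exact_mod_cast h

lemma tsum_char_mul_eisOf {β : ℂ} {χ : ℂ → ℂ} (hχ : IsResChar3 β χ) (hρ : χ ρ3 = ρ3) (h : ℝ → ℂ) :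
    ∑' p, χ (eisOf p) * eisOf p * h (normSq (eisOf p)) = 0 := by
  set S := ∑' p, χ (eisOf p) * eisOf p * h (normSq (eisOf p)) with hS
  have h1 : S = ρ3 ^ 2 * S := by
    rw [hS]
    nth_rewrite 1 [← rotEquiv.tsum_eq]
    rw [← tsum_mul_left]
    refine tsum_congr fun p => ?_
    rw [eisOf_rotEquiv, hχ.map_mul _ ρ3_mem _ (eisOf_mem p), hρ, normSq_mul, normSq_ρ3, one_mul]
    ring
  have h2 : (1 - ρ3 ^ 2) * S = 0 := by linear_combination h1
  refine (mul_eq_zero.1 h2).resolve_left fun h3 => ?_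
  rw [ρ3_sq] at h3
  have := congrArg re h3
  simp only [sub_re, neg_re, one_re, ρ3_re, zero_re] at this
  norm_num at this

lemma tsum_conj_char_mul_conj_eisOf {β : ℂ} {χ : ℂ → ℂ} (hχ : IsResChar3 β χ) (hρ : χ ρ3 = ρ3)
    (h : ℝ → ℝ) :
    ∑' p, (starRingEnd ℂ) (χ (eisOf p)) * (starRingEnd ℂ) (eisOf p) *
      (h (normSq (eisOf p)) : ℂ) = 0 := by
  have h1 := congrArg (starRingEnd ℂ) (tsum_char_mul_eisOf hχ hρ (fun x => (h x : ℂ)))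
  rw [conj_tsum, map_zero] at h1
  simpa only [map_mul, conj_ofReal] using h1

/-- The theta series of weight two attached to `χ(ν)·ν̄`. -/
def heckeTheta (χ : ℂ → ℂ) (t : ℝ) : ℂ :=
  ∑' p, χ (eisOf p) * (starRingEnd ℂ) (eisOf p) *
    ((Real.exp (-(2 * Real.pi / Real.sqrt 3 * t) * normSq (eisOf p)) : ℝ) : ℂ)

lemma summable_mul_mul_exp {a b : ℂ → ℂ} (ha : ∀ p, ‖a (eisOf p)‖ ≤ 1)
    (hb : ∃ C, ∀ z, ‖b z‖ ≤ C * ‖z‖) {r : ℝ} (hr : 0 < r) :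
    Summable fun p => a (eisOf p) * b (eisOf p) *
      ((Real.exp (-r * normSq (eisOf p)) : ℝ) : ℂ) := by
  obtain ⟨C, hC⟩ := hb
  refine ((summable_norm_mul_exp hr 0).mul_left C).of_norm_bounded fun p => ?_
  rw [norm_mul, norm_mul, norm_real, Real.norm_eq_abs, Real.abs_exp, sub_zero, normSq_eq_norm_sq,
    ← mul_assoc]
  refine mul_le_mul_of_nonneg_right ?_ (Real.exp_pos _).le
  have h1 := hC (eisOf p)
  calc ‖a (eisOf p)‖ * ‖b (eisOf p)‖ ≤ 1 * (C * ‖eisOf p‖) := by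
        gcongr
        exact ha p
    _ = _ := one_mul _

lemma heckeTheta_inversion {β : ℂ} {χ : ℂ → ℂ} (hχ : IsHeckeCond3 β χ) {T : Finset ℂ}
    (hT : IsCRS3 β T) {t : ℝ} (ht : 0 < t) :
    (∑ l ∈ T, χ l * eS3 (l / β)) * (starRingEnd ℂ) (heckeTheta χ t) =
      -((starRingEnd ℂ) (ρ3 / β)) / t ^ 2 * heckeTheta χ (normSq β * t)⁻¹ := by
  obtain ⟨hβ, hβ0, hχ, hW, hprim⟩ := hχ
  have hρ : χ ρ3 = ρ3 := hW _ (by simp)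
  have hN : 0 < normSq β := normSq_pos.2 hβ0
  have ht0 : (t : ℂ) ≠ 0 := by exact_mod_cast ht.ne'
  have hle (p) : ‖χ (eisOf p)‖ ≤ 1 := hχ.norm_le_one hT (eisOf_mem p)
  have hc : 0 < 2 * Real.pi / Real.sqrt 3 * t := by positivity
  have hc' : 0 < 2 * Real.pi / Real.sqrt 3 * (normSq β * t)⁻¹ := by positivity
  have h1 : (starRingEnd ℂ) (heckeTheta χ t) = 2 * I * ∑' p, (starRingEnd ℂ) (χ (eisOf p)) *
      ((eisOf p).im : ℂ) *
      ((Real.exp (-(2 * Real.pi / Real.sqrt 3 * t) * normSq (eisOf p)) : ℝ) : ℂ) := by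
    rw [heckeTheta, conj_tsum, ← sub_zero (tsum _), ← tsum_conj_char_mul_conj_eisOf hχ hρ
      (fun x => Real.exp (-(2 * Real.pi / Real.sqrt 3 * t) * x)), ← Summable.tsum_sub,
      ← tsum_mul_left]
    · refine tsum_congr fun p => ?_
      have := sub_conj (eisOf p)
      simp only [map_mul, conj_ofReal, conj_conj]
      push_cast at this ⊢
      linear_combination (starRingEnd ℂ) (χ (eisOf p)) *
        cexp (-(2 * Real.pi / Real.sqrt 3 * t) * normSq (eisOf p)) * this
    · simp only [map_mul, conj_ofReal, conj_conj]
      exact summable_mul_mul_exp (a := fun z => (starRingEnd ℂ) (χ z)) (b := fun z => z)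
        (fun p => by simpa using hle p) ⟨1, fun z => by simp⟩ hc
    · exact summable_mul_mul_exp (a := fun z => (starRingEnd ℂ) (χ z))
        (b := fun z => (starRingEnd ℂ) z)
        (fun p => by simpa using hle p) ⟨1, fun z => by simp⟩ hc
  have h2 : (∑ l ∈ T, χ l * eS3 (l / β)) * ∑' p, (starRingEnd ℂ) (χ (eisOf p)) *
      ((eisOf p).im : ℂ) *
      ((Real.exp (-(2 * Real.pi / Real.sqrt 3 * t) * normSq (eisOf p)) : ℝ) : ℂ) =
      ∑ l ∈ T, χ l * ∑' p, ((eisOf p).im : ℂ) * eS3 (l / β * eisOf p) *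
        cexp ((-(2 * Real.pi / Real.sqrt 3 * t) * normSq (eisOf p) : ℝ)) := by
    rw [← tsum_mul_left]
    simp only [← tsum_mul_left]
    rw [← Summable.tsum_finsetSum fun l _ => (summable_theta_left ht (l / β)).mul_left (χ l)]
    refine tsum_congr fun p => ?_
    rw [← mul_assoc, ← mul_assoc, mul_comm (∑ l ∈ T, _),
      ← sum_char_mul_eS3 hβ hβ0 hχ hprim hT (eisOf_mem p), Finset.sum_mul, Finset.sum_mul]
    refine Finset.sum_congr rfl fun l _ => ?_
    push_cast
    ring
  let g : ℂ → ℂ := fun z => χ z * ((ρ3 * z / β).re : ℂ) *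
    ((Real.exp (-(2 * Real.pi / Real.sqrt 3 * (normSq β * t)⁻¹) * normSq z) : ℝ) : ℂ)
  have hg : Summable fun p => g (eisOf p) :=
    summable_mul_mul_exp (b := fun z => ((ρ3 * z / β).re : ℂ)) hle ⟨‖ρ3 / β‖, fun z => by
      rw [norm_real, Real.norm_eq_abs, ← norm_mul, div_mul_eq_mul_div]
      exact abs_re_le_norm _⟩ hc'
  have h3 : ∀ l ∈ T, χ l * ∑' p, ((eisOf p).im : ℂ) * eS3 (l / β * eisOf p) *
        cexp ((-(2 * Real.pi / Real.sqrt 3 * t) * normSq (eisOf p) : ℝ)) =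
      I / t ^ 2 * ∑' p, g (l - β * eisOf p) := by
    intro l hl
    rw [theta_inversion ht, ← tsum_mul_left, ← tsum_mul_left, ← tsum_mul_left]
    refine tsum_congr fun p => ?_
    have e1 : χ (l - β * eisOf p) = χ l := hχ.periodic _
      (sub_mem (hT.1 l hl) (mul_mem hβ (eisOf_mem p))) _ (hT.1 l hl)
      ⟨-eisOf p, neg_mem (eisOf_mem p), by ring⟩
    have e2 : l - β * eisOf p = -β * (eisOf p - l / β) := by
      field_simp
      ring
    have e3 : (ρ3 * (l - β * eisOf p) / β) = -(ρ3 * (eisOf p - l / β)) := by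
      field_simp
      ring
    have e4 : -(2 * Real.pi / Real.sqrt 3 * (normSq β * t)⁻¹) * normSq (l - β * eisOf p) =
        -(2 * Real.pi / (Real.sqrt 3 * t)) * normSq (eisOf p - l / β) := by
      rw [e2, normSq_mul, normSq_neg]
      field_simp
    simp only [g]
    rw [e1, e3, e4, neg_re, ofReal_exp]
    push_cast
    ring
  have h4 : 2 * ∑' p, g (eisOf p) =
      (starRingEnd ℂ) (ρ3 / β) * heckeTheta χ (normSq β * t)⁻¹ := by
    have h5 := tsum_char_mul_eisOf hχ hρ (fun x =>
      ((Real.exp (-(2 * Real.pi / Real.sqrt 3 * (normSq β * t)⁻¹) * x) : ℝ) : ℂ))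
    rw [← add_zero (_ * heckeTheta _ _), ← mul_zero (ρ3 / β), ← h5, heckeTheta, ← tsum_mul_left,
      ← tsum_mul_left, ← tsum_mul_left, ← Summable.tsum_add]
    · refine tsum_congr fun p => ?_
      have h6 := add_conj (ρ3 * eisOf p / β)
      have h7 : (starRingEnd ℂ) (ρ3 * eisOf p / β) =
          (starRingEnd ℂ) (ρ3 / β) * (starRingEnd ℂ) (eisOf p) := by
        rw [← map_mul]
        congr 1
        ring
      rw [h7] at h6
      simp only [g]
      push_cast at h6
      linear_combination -χ (eisOf p) * ((Real.exp (-(2 * Real.pi / Real.sqrt 3 *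
        (normSq β * t)⁻¹) * normSq (eisOf p)) : ℝ) : ℂ) * h6
    · exact (summable_mul_mul_exp (b := fun z => (starRingEnd ℂ) z) hle
        ⟨1, fun z => by simp⟩ hc').mul_left _
    · exact (summable_mul_mul_exp (b := fun z => z) hle ⟨1, fun z => by simp⟩ hc').mul_left _
  rw [h1, mul_left_comm, h2, Finset.sum_congr rfl h3, ← Finset.mul_sum,
    hT.sum_tsum hβ hβ0 hg]
  have hI := I_sq
  rw [show -((starRingEnd ℂ) (ρ3 / β)) / (t : ℂ) ^ 2 * heckeTheta χ (normSq β * t)⁻¹ =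
    -(1 / (t : ℂ) ^ 2) * ((starRingEnd ℂ) (ρ3 / β) * heckeTheta χ (normSq β * t)⁻¹) by ring, ← h4]
  linear_combination 2 * (1 / (t : ℂ) ^ 2) * (∑' p, g (eisOf p)) * hI

section HeckeTheta

variable {χ : ℂ → ℂ}

lemma norm_char_mul_conj_le (hle : ∀ p, ‖χ (eisOf p)‖ ≤ 1) (p : ℤ × ℤ) :
    ‖χ (eisOf p) * (starRingEnd ℂ) (eisOf p)‖ ≤ ‖eisOf p‖ := by
  rw [norm_mul, RCLike.norm_conj]
  exact mul_le_of_le_one_left (norm_nonneg _) (hle p)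

lemma hasSum_heckeTheta (hle : ∀ p, ‖χ (eisOf p)‖ ≤ 1) {t : ℝ} (ht : 0 < t) :
    HasSum (fun p => χ (eisOf p) * (starRingEnd ℂ) (eisOf p) *
      ((Real.exp (-(2 * Real.pi / Real.sqrt 3 * normSq (eisOf p)) * t) : ℝ) : ℂ))
      (heckeTheta χ t) := by
  have h := (summable_mul_mul_exp (b := fun z => (starRingEnd ℂ) z) hle ⟨1, fun z => by simp⟩
    (show 0 < 2 * Real.pi / Real.sqrt 3 * t by positivity)).hasSum
  simpa only [heckeTheta, neg_mul, mul_right_comm _ t] using h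

lemma continuousOn_heckeTheta (hle : ∀ p, ‖χ (eisOf p)‖ ≤ 1) :
    ContinuousOn (heckeTheta χ) (Set.Ioi 0) := by
  intro t ht
  have ht : 0 < t := ht
  refine ContinuousAt.continuousWithinAt ?_
  have h : ContinuousOn (heckeTheta χ) (Set.Ici (t / 2)) := by
    refine continuousOn_tsum (u := fun p => ‖eisOf p - 0‖ *
      Real.exp (-(2 * Real.pi / Real.sqrt 3 * (t / 2)) * ‖eisOf p - 0‖ ^ 2))
      (fun p => by fun_prop) (summable_norm_mul_exp (by positivity) 0) fun p s hs => ?_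
    rw [norm_mul, norm_real, Real.norm_eq_abs, Real.abs_exp, sub_zero, normSq_eq_norm_sq]
    have hs : t / 2 ≤ s := hs
    gcongr
    exact norm_char_mul_conj_le hle p
  exact h.continuousAt (Ici_mem_nhds (by linarith))

lemma norm_heckeTheta_le (hle : ∀ p, ‖χ (eisOf p)‖ ≤ 1) :
    ∃ K, 0 ≤ K ∧ ∀ t, 1 ≤ t →
      ‖heckeTheta χ t‖ ≤ K * Real.exp (-(2 * Real.pi / Real.sqrt 3) * t) := by
  set c := 2 * Real.pi / Real.sqrt 3 with hc
  have hc0 : 0 < c := by positivity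
  have hs := (summable_norm_mul_exp hc0 0).mul_left (Real.exp c)
  refine ⟨∑' p, Real.exp c * (‖eisOf p - 0‖ * Real.exp (-c * ‖eisOf p - 0‖ ^ 2)),
    tsum_nonneg fun p => by positivity, fun t ht => ?_⟩
  refine tsum_of_norm_bounded (hs.hasSum.mul_right _) fun p => ?_
  rw [norm_mul, norm_real, Real.norm_eq_abs, Real.abs_exp, sub_zero, ← normSq_eq_norm_sq, ← hc]
  by_cases h0 : eisOf p = 0
  · simp [h0]
  have h1 := one_le_normSq (eisOf_mem p) h0
  calc _ ≤ ‖eisOf p‖ * Real.exp (c + -c * normSq (eisOf p) + -c * t) := by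
        refine mul_le_mul (norm_char_mul_conj_le hle p) ?_ (Real.exp_pos _).le (norm_nonneg _)
        rw [Real.exp_le_exp]
        have h2 : 0 ≤ c * ((t - 1) * (normSq (eisOf p) - 1)) :=
          mul_nonneg hc0.le (mul_nonneg (by linarith) (by linarith))
        linarith
    _ = _ := by
        rw [Real.exp_add, Real.exp_add]
        ring

open Asymptotics Filter Topology in
lemma heckeTheta_isBigO_atTop (hle : ∀ p, ‖χ (eisOf p)‖ ≤ 1) :
    heckeTheta χ =O[atTop] fun t => Real.exp (-(2 * Real.pi / Real.sqrt 3) * t) := by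
  obtain ⟨K, -, hK⟩ := norm_heckeTheta_le hle
  refine IsBigO.of_bound K ?_
  filter_upwards [eventually_ge_atTop 1] with t ht
  rw [Real.norm_eq_abs, Real.abs_exp]
  exact hK t ht

open Asymptotics Filter Topology in
lemma heckeTheta_isBigO_zero {β : ℂ} (hχ : IsHeckeCond3 β χ) {T : Finset ℂ} (hT : IsCRS3 β T) :
    heckeTheta χ =O[𝓝[>] 0] fun t : ℝ => t ^ (-(0 : ℝ)) := by
  have hle (p) : ‖χ (eisOf p)‖ ≤ 1 := hχ.2.2.1.norm_le_one hT (eisOf_mem p)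
  have hN : 0 < normSq β := normSq_pos.2 hχ.2.1
  obtain ⟨K, hK0, hK⟩ := norm_heckeTheta_le hle
  set c := 2 * Real.pi / Real.sqrt 3 with hc
  have hc0 : 0 < c := by positivity
  set G := ∑ l ∈ T, χ l * eS3 (l / β)
  refine IsBigO.of_bound (‖β‖ * (2 / c ^ 2) * (‖G‖ * K)) ?_
  filter_upwards [Ioo_mem_nhdsGT (inv_pos.2 hN)] with s hs
  have hs0 : 0 < s := hs.1
  set t := (normSq β * s)⁻¹ with htdef
  have ht1 : 1 ≤ t := by
    rw [htdef, one_le_inv₀ (by positivity)]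
    have := mul_lt_mul_of_pos_left hs.2 hN
    rw [mul_inv_cancel₀ hN.ne'] at this
    exact this.le
  have ht0 : 0 < t := by linarith
  have hst : (normSq β * t)⁻¹ = s := by
    rw [htdef]
    field_simp
  have h := congrArg norm (heckeTheta_inversion hχ hT ht0)
  have hρ : ‖ρ3‖ = 1 := by
    have h1 := normSq_ρ3
    rw [normSq_eq_norm_sq] at h1
    exact (pow_eq_one_iff_of_nonneg (norm_nonneg _) two_ne_zero).1 h1
  rw [hst, norm_mul, norm_mul, RCLike.norm_conj, norm_div, norm_neg, RCLike.norm_conj, norm_div,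
    hρ, norm_pow, norm_real, Real.norm_eq_abs, abs_of_pos ht0] at h
  have hβ : 0 < ‖β‖ := norm_pos_iff.2 hχ.2.1
  have h2 : ‖heckeTheta χ s‖ = ‖β‖ * t ^ 2 * (‖G‖ * ‖heckeTheta χ t‖) := by
    rw [h]
    field_simp
  have h3 : t ^ 2 * Real.exp (-c * t) ≤ 2 / c ^ 2 := by
    have h4 := Real.pow_div_factorial_le_exp (c * t) (by positivity) 2
    rw [neg_mul, Real.exp_neg, ← div_eq_mul_inv, div_le_div_iff₀ (Real.exp_pos _) (by positivity)]
    norm_num [Nat.factorial] at h4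
    nlinarith
  rw [h2, neg_zero, Real.rpow_zero, norm_one, mul_one]
  calc _ ≤ ‖β‖ * t ^ 2 * (‖G‖ * (K * Real.exp (-c * t))) := by
        gcongr
        exact hK t ht1
    _ = ‖β‖ * (t ^ 2 * Real.exp (-c * t)) * (‖G‖ * K) := by ring
    _ ≤ _ := by gcongr

lemma differentiableAt_mellin_heckeTheta {β : ℂ} (hχ : IsHeckeCond3 β χ) {T : Finset ℂ}
    (hT : IsCRS3 β T) {s : ℂ} (hs : 0 < s.re) :
    DifferentiableAt ℂ (mellin (heckeTheta χ)) s := by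
  have hle (p) : ‖χ (eisOf p)‖ ≤ 1 := hχ.2.2.1.norm_le_one hT (eisOf_mem p)
  exact mellin_differentiableAt_of_isBigO_rpow_exp (by positivity)
    ((continuousOn_heckeTheta hle).locallyIntegrableOn measurableSet_Ioi)
    (heckeTheta_isBigO_atTop hle) (heckeTheta_isBigO_zero hχ hT) hs

lemma mellin_heckeTheta_eq_tsum (hle : ∀ p, ‖χ (eisOf p)‖ ≤ 1) {s : ℂ} (hs : 3 / 2 < s.re) :
    mellin (heckeTheta χ) s = Gamma s * ((2 * Real.pi / Real.sqrt 3 : ℝ) : ℂ) ^ (-s) *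
      ∑' ν : O3, χ (ν : ℂ) * (starRingEnd ℂ) (ν : ℂ) * ((normSq (ν : ℂ) : ℂ) ^ (-s)) := by
  have hs0 : 0 < s.re := by linarith
  have hc0 : 0 < 2 * Real.pi / Real.sqrt 3 := by positivity
  have h := hasSum_mellin (a := fun p => χ (eisOf p) * (starRingEnd ℂ) (eisOf p))
    (p := fun p => 2 * Real.pi / Real.sqrt 3 * normSq (eisOf p)) (F := heckeTheta χ) (s := s)
    (fun p => ?_) hs0 (fun t ht => hasSum_heckeTheta hle ht) ?_
  · rw [← h.tsum_eq, ← eisEquiv.tsum_eq, ← tsum_mul_left]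
    refine tsum_congr fun p => ?_
    rw [eisEquiv_coe, ofReal_mul, mul_cpow_ofReal_nonneg hc0.le (normSq_nonneg _), cpow_neg,
      cpow_neg]
    ring
  · by_cases h0 : eisOf p = 0
    · simp [h0]
    · exact Or.inr (mul_pos hc0 (normSq_pos.2 h0))
  · refine ((summable_norm_eisOf_rpow (k := 2 * s.re - 1) (by linarith)).mul_left
      ((2 * Real.pi / Real.sqrt 3) ^ (-s.re))).of_nonneg_of_le (fun p => ?_) fun p => ?_
    · have := normSq_nonneg (eisOf p)
      positivity
    by_cases h0 : eisOf p = 0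
    · simp only [h0, map_zero, mul_zero, norm_zero, zero_div]
      positivity
    have hν : 0 < ‖eisOf p‖ := norm_pos_iff.2 h0
    calc _ ≤ ‖eisOf p‖ / (2 * Real.pi / Real.sqrt 3 * normSq (eisOf p)) ^ s.re := by
          have := normSq_nonneg (eisOf p)
          gcongr
          exact norm_char_mul_conj_le hle p
      _ = _ := by
          rw [Real.mul_rpow hc0.le (normSq_nonneg _), normSq_eq_norm_sq, ← Real.rpow_natCast,
            ← Real.rpow_mul hν.le, Real.rpow_neg hc0.le,
            show -(2 * s.re - 1) = 1 - ((2 : ℕ) : ℝ) * s.re by push_cast; ring,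
            Real.rpow_sub hν, Real.rpow_one]
          field_simp

lemma mellin_heckeTheta_one {β : ℂ} (hχ : IsHeckeCond3 β χ) {T : Finset ℂ} (hT : IsCRS3 β T)
    {L : ℂ} (hL : IsLValue3 χ L) :
    mellin (heckeTheta χ) 1 = ((6 / (2 * Real.pi / Real.sqrt 3) : ℝ) : ℂ) * L := by
  have hle (p) : ‖χ (eisOf p)‖ ≤ 1 := hχ.2.2.1.norm_le_one hT (eisOf_mem p)
  have hc0 : 0 < 2 * Real.pi / Real.sqrt 3 := by positivity
  obtain ⟨F, hFd, hFs, rfl⟩ := hL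
  set U : Set ℂ := {s : ℂ | 0 < s.re} with hU
  have hUo : IsOpen U := isOpen_lt continuous_const continuous_re
  have hUc : IsPreconnected U := (convex_halfSpace_re_gt 0).isPreconnected
  have h1 : AnalyticOnNhd ℂ (mellin (heckeTheta χ)) U := DifferentiableOn.analyticOnNhd
    (fun s hs => (differentiableAt_mellin_heckeTheta hχ hT hs).differentiableWithinAt) hUo
  have h2 : AnalyticOnNhd ℂ (fun s => Gamma s * ((2 * Real.pi / Real.sqrt 3 : ℝ) : ℂ) ^ (-s) *
      (6 * F s)) U := by
    refine DifferentiableOn.analyticOnNhd (fun s hs => ?_) hUo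
    have hs : 0 < s.re := hs
    have hG : DifferentiableAt ℂ Gamma s := differentiableAt_Gamma _ fun m hm => by
      rw [hm, neg_re, natCast_re] at hs
      linarith [m.cast_nonneg (α := ℝ)]
    have hc : DifferentiableAt ℂ (fun s : ℂ => ((2 * Real.pi / Real.sqrt 3 : ℝ) : ℂ) ^ (-s)) s :=
      (differentiableAt_id.neg).const_cpow (Or.inl (by exact_mod_cast hc0.ne'))
    exact (hG.mul hc).differentiableWithinAt.mul ((hFd s hs).const_mul 6)
  have h3 := h1.eqOn_of_preconnected_of_eventuallyEq h2 hUc (z₀ := 2) (by simp [hU]) (by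
    filter_upwards [(isOpen_lt continuous_const continuous_re).mem_nhds
      (show (2 : ℂ) ∈ {s : ℂ | 3 / 2 < s.re} by norm_num)] with s hs
    rw [mellin_heckeTheta_eq_tsum hle hs, hFs s hs]
    ring)
  have h4 := h3 (show (1 : ℂ) ∈ U by simp [hU])
  simp only at h4
  rw [h4, Gamma_one, cpow_neg, cpow_one]
  push_cast
  ring

end HeckeTheta

lemma mellin_heckeTheta_functional {β : ℂ} {χ : ℂ → ℂ} (hχ : IsHeckeCond3 β χ) {T : Finset ℂ}
    (hT : IsCRS3 β T) :
    mellin (heckeTheta χ) 1 =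
      (-ρ3 * β⁻¹ * ∑ l ∈ T, χ l * eS3 (l / β)) * (starRingEnd ℂ) (mellin (heckeTheta χ) 1) := by
  have hβ0 := hχ.2.1
  have hN : 0 < normSq β := normSq_pos.2 hβ0
  set G := ∑ l ∈ T, χ l * eS3 (l / β) with hG
  have h1 : mellin (fun t => G * (starRingEnd ℂ) (heckeTheta χ t)) 1 =
      G * (starRingEnd ℂ) (mellin (heckeTheta χ) 1) := by
    simp only [mellin, sub_self, cpow_zero, one_smul]
    rw [MeasureTheory.integral_const_mul, integral_conj]
  have h2 : mellin (fun t => G * (starRingEnd ℂ) (heckeTheta χ t)) 1 =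
      mellin (fun t => -((starRingEnd ℂ) (ρ3 / β)) •
        ((t : ℂ) ^ (-2 : ℂ) • (fun u : ℝ => heckeTheta χ u⁻¹) (normSq β * t))) 1 := by
    refine MeasureTheory.setIntegral_congr_fun measurableSet_Ioi fun t ht => ?_
    simp only [hG]
    rw [heckeTheta_inversion hχ hT ht, cpow_neg, show (2 : ℂ) = ((2 : ℕ) : ℂ) by norm_num,
      cpow_natCast]
    simp only [smul_eq_mul]
    ring
  have h3 : mellin (fun t => -((starRingEnd ℂ) (ρ3 / β)) •
        ((t : ℂ) ^ (-2 : ℂ) • (fun u : ℝ => heckeTheta χ u⁻¹) (normSq β * t))) 1 =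
      -((starRingEnd ℂ) (ρ3 / β)) * (normSq β * mellin (heckeTheta χ) 1) := by
    rw [mellin_const_smul, mellin_cpow_smul, mellin_comp_mul_left (fun u => heckeTheta χ u⁻¹) _ hN, mellin_comp_inv]
    norm_num
  have h4 := h1.symm.trans (h2.trans h3)
  have h5 : (starRingEnd ℂ) ρ3 * ρ3 = 1 := by
    rw [conj_ρ3, ← pow_succ, ρ3_cube]
  have h6 : (normSq β : ℂ) = (starRingEnd ℂ) β * β := normSq_eq_conj_mul_self
  have hβ' : (starRingEnd ℂ) β ≠ 0 := (map_ne_zero _).2 hβ0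
  rw [mul_assoc, h4, h6, map_div₀]
  field_simp
  linear_combination -(mellin (heckeTheta χ) 1) * h5

/-- **Lemma I.2 (central value equation).** Let `χ̃` be a Hecke character of weight
one of `ℚ(ρ)` with conductor `(β)`. Then `L(1, χ̃) = C(χ̃)·conj(L(1, χ̃))`, where the
root number is `C(χ̃) = −ρ·β⁻¹·Σ_{λ mod β} χ₁(λ)·e^{2πi·S(λ/β)}`. -/
theorem stmt_6
    (β : ℂ) (χ₁ : ℂ → ℂ) (hχ₁ : IsHeckeCond3 β χ₁)
    (T : Finset ℂ) (hT : IsCRS3 β T)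
    (L : ℂ) (hL : IsLValue3 χ₁ L) :
    L = (-ρ3 * β⁻¹ * ∑ l ∈ T, χ₁ l * eS3 (l / β)) * (starRingEnd ℂ) L := by
  have h := mellin_heckeTheta_functional hχ₁ hT
  rw [mellin_heckeTheta_one hχ₁ hT hL, map_mul, conj_ofReal] at h
  have hc : ((6 / (2 * Real.pi / Real.sqrt 3) : ℝ) : ℂ) ≠ 0 := by
    have : (6 / (2 * Real.pi / Real.sqrt 3) : ℝ) ≠ 0 := by positivity
    exact_mod_cast this
  exact mul_left_cancel₀ hc (by linear_combination h)

end
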